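/- Let N be a nilpotent endomorphism of V, set V_* = V^N_*, and let S ∈ E_{≥3}V_*. Then there exists T ∈ E_{≥1}V_* such that (1+T)N = (N+S)(1+T); equivalently (since 1+T is invertible), N+S = (1+T)∘N∘(1+T)^{−1}. In other words, the conjugation action of the group 1+E_{≥1}V_* on N + E_{≥3}V_* is transitive. -/

import Mathlib

/-- The canonical (Dynkin–Kostant) filtration attached to a nilpotent endomorphism:
`V^N_{≥a} = Σ_{j ≥ max(0,a)} N^j (ker N^{2j−a+1})`. -/
noncomputable def canonFilt {k : Type*} [Field k] {V : Type*} [AddCommGroup V] [Module k V]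
    (N : V →ₗ[k] V) (a : ℤ) : Submodule k V :=
  ⨆ j : {j : ℕ // a ≤ (j : ℤ)},
    Submodule.map (N ^ (j : ℕ)) (LinearMap.ker (N ^ (2 * ((j : ℕ) : ℤ) - a + 1).toNat))

open Polynomial DirectSum in
/-- A nilpotent endomorphism has generators `e i` of Jordan blocks of sizes `d i`: they extend
freely to intertwining maps, and the kernels of powers are spanned by iterates of generators. -/
theorem exists_jordan_generators {k V : Type*} [Field k] [AddCommGroup V] [Module k V]
    [FiniteDimensional k V] (N : V →ₗ[k] V) (hN : IsNilpotent N) :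
    ∃ (n : ℕ) (d : Fin n → ℕ) (e : Fin n → V),
      (∀ i, (N ^ d i) (e i) = 0) ∧
      (∀ (M : V →ₗ[k] V) (w : Fin n → V), (∀ i, (M ^ d i) (w i) = 0) →
        ∃ g : V →ₗ[k] V, g ∘ₗ N = M ∘ₗ g ∧ ∀ i, g (e i) = w i) ∧
      (∀ m y, (N ^ m) y = 0 →
        y ∈ Submodule.span k {v | ∃ i r, d i ≤ r + m ∧ v = (N ^ r) (e i)}) := by
  classical
  obtain ⟨s, hs⟩ := hN
  obtain ⟨n, d, ⟨φ⟩⟩ := Module.torsion_by_prime_power_decomposition (R := k[X])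
    (M := Module.AEval' N) (p := X) irreducible_X
    ((Submodule.isTorsion'_powers_iff _).mpr fun x => ⟨s, by
      obtain ⟨x, rfl⟩ := (Module.AEval'.of N).surjective x
      rw [Module.AEval'.X_pow_smul_of, hs, zero_smul, map_zero]⟩)
  let gen (i : Fin n) : Module.AEval' N :=
    φ.symm (DirectSum.lof k[X] (Fin n) (fun i => k[X] ⧸ k[X] ∙ (X : k[X]) ^ d i) i
      (Submodule.Quotient.mk 1))
  have smul_gen (i) (p : k[X]) : p • gen i =
      φ.symm (DirectSum.lof k[X] (Fin n) (fun i => k[X] ⧸ k[X] ∙ (X : k[X]) ^ d i) i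
        (Submodule.Quotient.mk p)) := by
    rw [← map_smul, ← map_smul, ← Submodule.Quotient.mk_smul, smul_eq_mul, mul_one]
  have of_symm_pow (r : ℕ) (x : Module.AEval' N) :
      (Module.AEval'.of N).symm ((X : k[X]) ^ r • x) = (N ^ r) ((Module.AEval'.of N).symm x) := by
    rw [Module.AEval.of_symm_smul, aeval_X_pow, Module.End.smul_def]
  refine ⟨n, d, fun i => (Module.AEval'.of N).symm (gen i), fun i => ?_, fun M w hw => ?_,
    fun m y hy => ?_⟩
  · rw [← of_symm_pow, smul_gen,
      (Submodule.Quotient.mk_eq_zero _).mpr (Submodule.mem_span_singleton_self _)]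
    simp
  · let f : (⨁ i, k[X] ⧸ k[X] ∙ (X : k[X]) ^ d i) →ₗ[k[X]] Module.AEval' M :=
      DirectSum.toModule k[X] (Fin n) _ fun i =>
        Submodule.liftQSpanSingleton _ (LinearMap.toSpanSingleton k[X] _ (Module.AEval'.of M (w i)))
          (by
            rw [LinearMap.toSpanSingleton_apply, Module.AEval'.X_pow_smul_of,
              Module.End.smul_def, hw, map_zero])
    let g : Module.AEval' N →ₗ[k[X]] Module.AEval' M := f ∘ₗ φ.toLinearMap
    refine ⟨(Module.AEval'.of M).symm.toLinearMap ∘ₗ g.restrictScalars k ∘ₗ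
      (Module.AEval'.of N).toLinearMap, ?_, fun i => ?_⟩
    · ext x
      simp only [LinearMap.comp_apply, LinearEquiv.coe_coe, LinearMap.restrictScalars_apply,
        ← Module.AEval'.X_smul_of, map_smul, Module.AEval'.of_symm_X_smul]
    · simp only [LinearMap.comp_apply, LinearEquiv.coe_coe, LinearMap.restrictScalars_apply, g, f,
        gen, LinearEquiv.apply_symm_apply, DirectSum.toModule_lof,
        Submodule.liftQSpanSingleton_apply, LinearMap.toSpanSingleton_apply, one_smul,
        LinearEquiv.symm_apply_apply]
  · obtain ⟨z, hz⟩ : ∃ z, φ.symm z = Module.AEval'.of N y := φ.symm.surjective _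
    have hz0 : (X : k[X]) ^ m • z = 0 := by
      apply φ.symm.injective
      rw [map_smul, hz, Module.AEval'.X_pow_smul_of, Module.End.smul_def, hy, map_zero, map_zero]
    have hzi (i) : (X : k[X]) ^ m • z i = 0 := by
      rw [← DirectSum.smul_apply, hz0, DirectSum.zero_apply]
    choose p hp using fun i => Submodule.Quotient.mk_surjective _ (z i)
    have hy' : y = ∑ i, (Module.AEval'.of N).symm (p i • gen i) := by
      rw [← map_sum]
      apply (Module.AEval'.of N).injective
      rw [LinearEquiv.apply_symm_apply, ← hz]
      simp only [smul_gen, hp, ← map_sum]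
      congr 1
      exact (DirectSum.sum_univ_of z).symm
    rw [hy']
    refine Submodule.sum_mem _ fun i _ => ?_
    rw [Polynomial.as_sum_support (p i), Finset.sum_smul, map_sum]
    refine Submodule.sum_mem _ fun r hr => ?_
    rw [← C_mul_X_pow_eq_monomial, mul_smul, Module.AEval.C_smul, map_smul, of_symm_pow]
    refine Submodule.smul_mem _ _ (Submodule.subset_span ⟨i, r, ?_, rfl⟩)
    have h := hzi i
    rw [← hp, ← Submodule.Quotient.mk_smul, Submodule.Quotient.mk_eq_zero,
      Ideal.submodule_span_eq, Ideal.mem_span_singleton, smul_eq_mul, X_pow_dvd_iff] at h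
    by_contra! hlt
    exact mem_support_iff.mp hr (coeff_X_pow_mul (p i) m r ▸ h (r + m) hlt)

section canonFilt

variable {k V : Type*} [Field k] [AddCommGroup V] [Module k V] {N : V →ₗ[k] V}

theorem pow_apply_mem_canonFilt {a : ℤ} {j m : ℕ} (haj : a ≤ j) (hm : m + a ≤ 2 * j + 1)
    {x : V} (hx : (N ^ m) x = 0) : (N ^ j) x ∈ canonFilt N a := by
  refine Submodule.mem_iSup_of_mem (⟨j, haj⟩ : {j : ℕ // a ≤ (j : ℤ)}) ⟨x, ?_, rfl⟩
  exact Module.End.pow_map_zero_of_le (by dsimp only; omega) hx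

theorem canonFilt_le {a : ℤ} {P : Submodule k V}
    (h : ∀ (j m : ℕ) (x : V), a ≤ j → (m : ℤ) + a = 2 * j + 1 → (N ^ m) x = 0 → (N ^ j) x ∈ P) :
    canonFilt N a ≤ P := by
  refine iSup_le ?_
  rintro ⟨j, hj⟩ _ ⟨x, hx, rfl⟩
  exact h j _ x hj (by dsimp only; omega) hx

theorem canonFilt_antitone : Antitone (canonFilt N) := fun _ _ hab =>
  canonFilt_le fun _ _ _ hj hm hx => pow_apply_mem_canonFilt (by omega) (by omega) hx

theorem apply_mem_canonFilt {a : ℤ} {x : V} (hx : x ∈ canonFilt N a) :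
    N x ∈ canonFilt N (a + 2) := by
  suffices canonFilt N a ≤ (canonFilt N (a + 2)).comap N from this hx
  refine canonFilt_le fun j m x hj hm hx => ?_
  rw [Submodule.mem_comap, ← Module.End.mul_apply, ← pow_succ']
  obtain h | h := hj.lt_or_eq
  · exact pow_apply_mem_canonFilt (by push_cast; omega) (by push_cast; omega) hx
  · rw [Module.End.pow_map_zero_of_le (by omega) hx]
    exact zero_mem _

theorem canonFilt_eq_bot {n : ℕ} (hn : N ^ n = 0) {a : ℤ} (ha : n ≤ a) : canonFilt N a = ⊥ := by
  refine le_bot_iff.mp (canonFilt_le fun j m x hj _ _ => ?_)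
  rw [pow_eq_zero_of_le (by omega) hn]
  simp

theorem exists_pow_apply_eq_of_mem_canonFilt {c : ℤ} {d : ℕ} (hdc : d ≤ c) {y : V}
    (hy : y ∈ canonFilt N c) : ∃ x ∈ canonFilt N (c - 2 * d), (N ^ d) x = y := by
  suffices canonFilt N c ≤ (canonFilt N (c - 2 * d)).map (N ^ d) from this hy
  refine canonFilt_le fun j m x hj hm hx => ⟨(N ^ (j - d)) x, ?_, ?_⟩
  · exact pow_apply_mem_canonFilt (by omega) (by omega) hx
  · rw [← Module.End.mul_apply, ← pow_add]
    congr 2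
    omega

theorem pow_apply_mem_canonFilt_add {M : V →ₗ[k] V}
    (hM : ∀ a, ∀ x ∈ canonFilt N a, M x ∈ canonFilt N (a + 2)) (r : ℕ) {a : ℤ} {x : V}
    (hx : x ∈ canonFilt N a) : (M ^ r) x ∈ canonFilt N (a + 2 * r) := by
  induction r with
  | zero => simpa using hx
  | succ r ih =>
    rw [pow_succ', Module.End.mul_apply]
    convert hM _ _ ih using 2
    push_cast
    ring

theorem add_apply_mem_canonFilt {S : V →ₗ[k] V}
    (hS : ∀ a : ℤ, ∀ x ∈ canonFilt N a, S x ∈ canonFilt N (a + 3))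
    (a : ℤ) (x : V) (hx : x ∈ canonFilt N a) :
    (N + S) x ∈ canonFilt N (a + 2) :=
  add_mem (apply_mem_canonFilt hx) (canonFilt_antitone (by omega) (hS a x hx))

theorem add_pow_sub_pow_apply_mem_canonFilt {S : V →ₗ[k] V}
    (hS : ∀ a : ℤ, ∀ x ∈ canonFilt N a, S x ∈ canonFilt N (a + 3))
    (r : ℕ) {a : ℤ} {x : V} (hx : x ∈ canonFilt N a) :
    ((N + S) ^ r) x - (N ^ r) x ∈ canonFilt N (a + 2 * r + 1) := by
  induction r with
  | zero => simp
  | succ r ih =>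
    have h₁ := add_apply_mem_canonFilt hS _ _ ih
    have h₂ := hS _ _ (pow_apply_mem_canonFilt_add (fun _ _ => apply_mem_canonFilt) r hx)
    convert add_mem (canonFilt_antitone (a := a + 2 * (r + 1 : ℕ) + 1) (by push_cast; omega) h₁)
      (canonFilt_antitone (by push_cast; omega) h₂) using 1
    simp only [pow_succ', Module.End.mul_apply, map_sub, LinearMap.add_apply]
    abel

theorem exists_add_pow_apply_eq_of_mem_canonFilt {S : V →ₗ[k] V}
    (hS : ∀ a : ℤ, ∀ x ∈ canonFilt N a, S x ∈ canonFilt N (a + 3))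
    (hN : IsNilpotent N) {d : ℕ} {c : ℤ} (hdc : d ≤ c) {y : V} (hy : y ∈ canonFilt N c) :
    ∃ x ∈ canonFilt N (c - 2 * d), ((N + S) ^ d) x = y := by
  obtain ⟨n, hn⟩ := hN
  obtain ⟨m, hm⟩ : ∃ m : ℕ, n ≤ c + m := ⟨(n - c).toNat, by omega⟩
  induction m generalizing c y with
  | zero =>
    rw [canonFilt_eq_bot hn (by simpa using hm), Submodule.mem_bot] at hy
    exact ⟨0, zero_mem _, by simp [hy]⟩
  | succ m ih =>
    obtain ⟨x, hx, rfl⟩ := exists_pow_apply_eq_of_mem_canonFilt hdc hy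
    have h := add_pow_sub_pow_apply_mem_canonFilt hS d hx
    obtain ⟨z, hz, hzx⟩ := ih (c := c + 1) (by omega)
      (canonFilt_antitone (by omega) h) (by push_cast at hm; omega)
    refine ⟨x - z, sub_mem hx (canonFilt_antitone (by omega) hz), ?_⟩
    rw [map_sub, hzx]
    abel

end canonFilt

/-- the conjugation action of `1 + E_{≥1}V^N_*` on `N + E_{≥3}V^N_*` is
transitive: for `S ∈ E_{≥3}V^N_*` there is `T ∈ E_{≥1}V^N_*` with
`(1+T)∘N = (N+S)∘(1+T)`. -/
theorem stmt_6
    (k : Type*) [Field k] (V : Type*) [AddCommGroup V] [Module k V]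
    [FiniteDimensional k V]
    (N : V →ₗ[k] V) (hN : IsNilpotent N)
    (S : V →ₗ[k] V)
    (hS : ∀ a : ℤ, ∀ x ∈ canonFilt N a, S x ∈ canonFilt N (a + 3)) :
    ∃ T : V →ₗ[k] V,
      (∀ a : ℤ, ∀ x ∈ canonFilt N a, T x ∈ canonFilt N (a + 1)) ∧
      (1 + T) ∘ₗ N = (N + S) ∘ₗ (1 + T) := by
  obtain ⟨n, d, e, he, hlift, hspan⟩ := exists_jordan_generators N hN
  have he_mem (i) : e i ∈ canonFilt N (1 - d i) := by
    obtain h | h := Nat.eq_zero_or_pos (d i)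
    · have := he i
      rw [h, pow_zero, Module.End.one_apply] at this
      rw [this]
      exact zero_mem _
    · simpa using pow_apply_mem_canonFilt (j := 0) (a := 1 - d i) (by push_cast; omega)
        (by push_cast; omega) (he i)
  have hu (i) : ∃ u ∈ canonFilt N (2 - d i), ((N + S) ^ d i) u = ((N + S) ^ d i) (e i) := by
    have h := add_pow_sub_pow_apply_mem_canonFilt hS (d i) (he_mem i)
    rw [he, sub_zero] at h
    obtain ⟨u, hu, hue⟩ := exists_add_pow_apply_eq_of_mem_canonFilt hS hN (d := d i) (by omega) h
    exact ⟨u, canonFilt_antitone (by omega) hu, hue⟩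
  choose u hu hue using hu
  obtain ⟨g, hg, hge⟩ := hlift (N + S) (fun i => e i - u i) (by simp [hue])
  have hpow (r : ℕ) (x : V) : g ((N ^ r) x) = ((N + S) ^ r) (g x) := by
    induction r with
    | zero => rfl
    | succ r ih =>
      rw [pow_succ', pow_succ', Module.End.mul_apply, Module.End.mul_apply, ← ih]
      exact LinearMap.congr_fun hg _
  refine ⟨g - 1, fun a => ?_, by simpa using hg⟩
  refine canonFilt_le (P := (canonFilt N (a + 1)).comap (g - 1)) fun j m x hj hm hx => ?_
  suffices Submodule.span k {v | ∃ i r, d i ≤ r + m ∧ v = (N ^ r) (e i)} ≤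
      ((canonFilt N (a + 1)).comap (g - 1)).comap (N ^ j) from this (hspan m x hx)
  rw [Submodule.span_le]
  rintro _ ⟨i, r, hr, rfl⟩
  simp only [SetLike.mem_coe, Submodule.mem_comap, ← Module.End.mul_apply (N ^ j), ← pow_add]
  have h₁ := add_pow_sub_pow_apply_mem_canonFilt hS (j + r) (he_mem i)
  have h₂ := pow_apply_mem_canonFilt_add (add_apply_mem_canonFilt hS) (j + r) (hu i)
  convert sub_mem (canonFilt_antitone (a := a + 1) (by push_cast; omega) h₁)
    (canonFilt_antitone (by push_cast; omega) h₂) using 1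
  rw [LinearMap.sub_apply, hpow, hge, map_sub, Module.End.one_apply]
  abel
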